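/- For every k ≥ 0 and every S ⊆ I: E^k·v_S = [k]_q!·q^{k(k−1)/2}·Σ (−q)^{w_{>i_1}(S)+⋯+w_{>i_k}(S)}·v_{S∪{i_1,−i_1,…,i_k,−i_k}}, the sum over all i_1 < ⋯ < i_k in {1,…,n} with {i_t,−i_t} ⊆ S₀^c for all t; and F^k·v_S = [k]_q!·q^{k(k−1)/2}·Σ (−q)^{w_{<i_1}(S)+⋯+w_{<i_k}(S)}·v_{S∖{i_1,−i_1,…,i_k,−i_k}}, the sum over all i_1 < ⋯ < i_k in {1,…,n} with {i_t,−i_t} ⊆ S₀ for all t. In particular the divided powers E^{(k)} := E^k/[k]_q! and F^{(k)} := F^k/[k]_q! map Λ_A into Λ_A. -/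

import Mathlib

noncomputable section

/-- The field `𝔽 = ℚ(q)`. -/
abbrev Fq : Type := RatFunc ℚ

/-- The quantum parameter `q`. -/
def qv : Fq := RatFunc.X

/-- The index set `I = {1,…,n} ∪ {−n,…,−1}` as a finset of integers. -/
def Iset (n : ℕ) : Finset ℤ := (Finset.Icc (-(n : ℤ)) (n : ℤ)).erase 0

/-- Subsets of `I`, the index type for the standard basis. -/
abbrev Bset (n : ℕ) : Type := {S : Finset ℤ // S ⊆ Iset n}

/-- `Λ`, the free `𝔽`-vector space with basis `{v_S : S ⊆ I}`. -/
abbrev Lam (n : ℕ) : Type := Bset n →₀ Fq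

/-- The standard basis vector `v_S`. -/
def bv (n : ℕ) (S : Bset n) : Lam n := Finsupp.single S 1

/-- The standard basis vector `v_T` for a finset `T ⊆ I` (and `0` for junk input). -/
def vS (n : ℕ) (T : Finset ℤ) : Lam n :=
  if h : T ⊆ Iset n then Finsupp.single (⟨T, h⟩ : Bset n) (1 : Fq) else 0

/-- The linear operator on `Λ` determined by prescribed values on the standard basis. -/
def mkOp (n : ℕ) (g : Bset n → Lam n) : Module.End Fq (Lam n) :=
  Finsupp.linearCombination Fq g

/-- The four positions `{i, i+1, −i, −(i+1)}`. -/
def quad (i : ℤ) : Finset ℤ := {i, i + 1, -i, -(i + 1)}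

/-- Value of `f_i` on `v_S`. -/
def fAct (n : ℕ) (i : ℤ) (S : Finset ℤ) : Lam n :=
  if i = (n : ℤ) then
    (if (n : ℤ) ∈ S ∧ -(n : ℤ) ∉ S then vS n (insert (-(n : ℤ)) (S.erase (n : ℤ))) else 0)
  else
    (if S ∩ quad i = {i} then vS n (insert (i + 1) (S.erase i))
     else if S ∩ quad i = {-(i + 1)} then vS n (insert (-i) (S.erase (-(i + 1))))
     else if S ∩ quad i = ({i, -(i + 1)} : Finset ℤ) then
       vS n (insert (-i) (S.erase (-(i + 1)))) + qv⁻¹ • vS n (insert (i + 1) (S.erase i))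
     else if S ∩ quad i = ({i, -i} : Finset ℤ) then qv • vS n (insert (i + 1) (S.erase i))
     else if S ∩ quad i = ({i + 1, -(i + 1)} : Finset ℤ) then
       vS n (insert (-i) (S.erase (-(i + 1))))
     else if S ∩ quad i = ({i, -(i + 1), -i} : Finset ℤ) then vS n (insert (i + 1) (S.erase i))
     else if S ∩ quad i = ({i, i + 1, -(i + 1)} : Finset ℤ) then
       vS n (insert (-i) (S.erase (-(i + 1))))
     else 0)

/-- Value of `e_i` on `v_S`. -/
def eAct (n : ℕ) (i : ℤ) (S : Finset ℤ) : Lam n :=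
  if i = (n : ℤ) then
    (if -(n : ℤ) ∈ S ∧ (n : ℤ) ∉ S then vS n (insert (n : ℤ) (S.erase (-(n : ℤ)))) else 0)
  else
    (if S ∩ quad i = {-i} then vS n (insert (-(i + 1)) (S.erase (-i)))
     else if S ∩ quad i = {i + 1} then vS n (insert i (S.erase (i + 1)))
     else if S ∩ quad i = ({i + 1, -i} : Finset ℤ) then
       vS n (insert i (S.erase (i + 1))) + qv⁻¹ • vS n (insert (-(i + 1)) (S.erase (-i)))
     else if S ∩ quad i = ({i, -i} : Finset ℤ) then qv • vS n (insert (-(i + 1)) (S.erase (-i)))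
     else if S ∩ quad i = ({i + 1, -(i + 1)} : Finset ℤ) then vS n (insert i (S.erase (i + 1)))
     else if S ∩ quad i = ({i, i + 1, -i} : Finset ℤ) then
       vS n (insert (-(i + 1)) (S.erase (-i)))
     else if S ∩ quad i = ({i + 1, -(i + 1), -i} : Finset ℤ) then vS n (insert i (S.erase (i + 1)))
     else 0)

/-- Coefficient of `ε_j` in `wt(S)`. -/
def epsCoef (S : Finset ℤ) (j : ℤ) : ℤ :=
  (if j ∈ S then 1 else 0) - (if -j ∈ S then 1 else 0)

/-- The pairing `(α_i, wt S)`. -/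
def alphaPair (n : ℕ) (i : ℤ) (S : Finset ℤ) : ℤ :=
  if i = (n : ℤ) then 2 * epsCoef S (n : ℤ) else epsCoef S i - epsCoef S (i + 1)

/-- The operator `f_i` on `Λ`. -/
def fop (n : ℕ) (i : ℤ) : Module.End Fq (Lam n) := mkOp n (fun S => fAct n i S.1)

/-- The operator `e_i` on `Λ`. -/
def eop (n : ℕ) (i : ℤ) : Module.End Fq (Lam n) := mkOp n (fun S => eAct n i S.1)

/-- The operator `k_i` on `Λ`, `k_i · v_S = q^{(α_i, wt S)} v_S`. -/
def kop (n : ℕ) (i : ℤ) : Module.End Fq (Lam n) :=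
  mkOp n (fun S => (qv ^ alphaPair n i S.1) • bv n S)

/-- The operator `k_i⁻¹` on `Λ`. -/
def kinvop (n : ℕ) (i : ℤ) : Module.End Fq (Lam n) :=
  mkOp n (fun S => (qv ^ (-alphaPair n i S.1)) • bv n S)

/-- `−S`. -/
def negSet (S : Finset ℤ) : Finset ℤ := S.image (fun x => -x)

/-- `S₀ = S ∩ (−S)`, the fully dotted columns. -/
def Szero (S : Finset ℤ) : Finset ℤ := S ∩ negSet S

/-- `S₀^c = (I∖S) ∩ (−(I∖S))`, the undotted columns. -/
def Szeroc (n : ℕ) (S : Finset ℤ) : Finset ℤ := (Iset n \ S) ∩ negSet (Iset n \ S)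

/-- `w(S) = (|S₀| − |S₀^c|)/2`. -/
def wTot (n : ℕ) (S : Finset ℤ) : ℤ :=
  (((Szero S).card : ℤ) - ((Szeroc n S).card : ℤ)) / 2

/-- `w_{>i}(S)`. -/
def wGt (n : ℕ) (i : ℤ) (S : Finset ℤ) : ℤ :=
  ((((Szero S).filter (fun x => i < |x| ∧ |x| ≤ (n : ℤ))).card : ℤ)
    - (((Szeroc n S).filter (fun x => i < |x| ∧ |x| ≤ (n : ℤ))).card : ℤ)) / 2

/-- `w_{<i}(S)`. -/
def wLt (n : ℕ) (i : ℤ) (S : Finset ℤ) : ℤ :=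
  ((((Szeroc n S).filter (fun x => x ≠ 0 ∧ |x| < i)).card : ℤ)
    - (((Szero S).filter (fun x => x ≠ 0 ∧ |x| < i)).card : ℤ)) / 2

/-- Value of `E` on `v_S`. -/
def EAct (n : ℕ) (S : Finset ℤ) : Lam n :=
  ∑ i ∈ (Finset.Icc (1 : ℤ) (n : ℤ)).filter (fun i => i ∈ Szeroc n S ∧ -i ∈ Szeroc n S),
    ((-qv) ^ wGt n i S) • vS n (insert i (insert (-i) S))

/-- Value of `F` on `v_S`. -/
def FAct (n : ℕ) (S : Finset ℤ) : Lam n :=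
  ∑ i ∈ (Finset.Icc (1 : ℤ) (n : ℤ)).filter (fun i => i ∈ Szero S ∧ -i ∈ Szero S),
    ((-qv) ^ wLt n i S) • vS n ((S.erase i).erase (-i))

/-- The operator `E` on `Λ`. -/
def Eop (n : ℕ) : Module.End Fq (Lam n) := mkOp n (fun S => EAct n S.1)

/-- The operator `F` on `Λ`. -/
def Fop (n : ℕ) : Module.End Fq (Lam n) := mkOp n (fun S => FAct n S.1)

/-- The operator `K` on `Λ`, `K · v_S = (−q)^{w(S)} v_S`. -/
def Kop (n : ℕ) : Module.End Fq (Lam n) := mkOp n (fun S => ((-qv) ^ wTot n S.1) • bv n S)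

/-- The operator `K⁻¹` on `Λ`. -/
def Kinvop (n : ℕ) : Module.End Fq (Lam n) :=
  mkOp n (fun S => ((-qv) ^ (-wTot n S.1)) • bv n S)

/-- Balanced quantum integer `[m]_x`. -/
def qNum (x : Fq) (m : ℕ) : Fq := (x ^ (m : ℤ) - x ^ (-(m : ℤ))) / (x - x⁻¹)

/-- Quantum factorial `[m]_x!`. -/
def qFact (x : Fq) (m : ℕ) : Fq := ∏ j ∈ Finset.range m, qNum x (j + 1)

/-- Gaussian binomial coefficient in the variable `x`. -/
def qBinom (x : Fq) (m s : ℕ) : Fq := qFact x m / (qFact x s * qFact x (m - s))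

/-- The variable `q_i`: `q` for `i < n` and `q²` for `i = n`. -/
def qsub (n : ℕ) (i : ℤ) : Fq := if i = (n : ℤ) then qv ^ 2 else qv

/-- The subring `A = ℤ[q,q⁻¹] ⊆ 𝔽`. -/
def Asub : Subring Fq := Subring.closure {qv, qv⁻¹}

/-- The `A`-lattice `Λ_A ⊆ Λ`: the `A`-span of all `v_S`. -/
def LamA (n : ℕ) : Set (Lam n) :=
  {x | ∃ c : Bset n →₀ Fq, (∀ S, c S ∈ Asub) ∧ x = c.sum (fun S a => a • bv n S)}

/-- The degree-`k` part `Λ^k ⊆ Λ`. -/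
def Lk (n k : ℕ) : Submodule Fq (Lam n) :=
  Submodule.span Fq {x | ∃ S : Bset n, S.1.card = k ∧ x = bv n S}

/-- The divided power `E^{(m)} = E^m/[m]!`. -/
def Ediv (n : ℕ) (m : ℕ) : Module.End Fq (Lam n) := (qFact qv m)⁻¹ • (Eop n ^ m)

/-- The divided power `F^{(m)} = F^m/[m]!`. -/
def Fdiv (n : ℕ) (m : ℕ) : Module.End Fq (Lam n) := (qFact qv m)⁻¹ • (Fop n ^ m)

section PowerExpansion

variable {α β : Type*} [DecidableEq α]

theorem Finset.sum_sum_powersetCard_erase {M : Type*} [AddCommMonoid M] (U : Finset α) (k : ℕ)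
    (f : α → Finset α → M) :
    ∑ i ∈ U, ∑ X ∈ (U.erase i).powersetCard k, f i X =
      ∑ Y ∈ U.powersetCard (k + 1), ∑ i ∈ Y, f i (Y.erase i) := by
  rw [Finset.sum_sigma', Finset.sum_sigma']
  refine Finset.sum_bij' (fun a _ => ⟨insert a.1 a.2, a.1⟩) (fun b _ => ⟨b.2, b.1.erase b.2⟩)
    ?_ ?_ ?_ ?_ ?_
  · rintro ⟨i, X⟩ h
    simp only [Finset.mem_sigma, Finset.mem_powersetCard, Finset.subset_erase] at h ⊢
    obtain ⟨hi, ⟨hX, hiX⟩, hk⟩ := h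
    exact ⟨⟨Finset.insert_subset hi hX, by rw [Finset.card_insert_of_notMem hiX, hk]⟩,
      Finset.mem_insert_self _ _⟩
  · rintro ⟨Y, i⟩ h
    simp only [Finset.mem_sigma, Finset.mem_powersetCard] at h ⊢
    obtain ⟨⟨hY, hk⟩, hi⟩ := h
    exact ⟨hY hi, Finset.erase_subset_erase _ hY, by rw [Finset.card_erase_of_mem hi, hk]; rfl⟩
  · rintro ⟨i, X⟩ h
    simp only [Finset.mem_sigma, Finset.mem_powersetCard, Finset.subset_erase] at h
    simp [Finset.erase_insert h.2.1.2]
  · rintro ⟨Y, i⟩ h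
    simp only [Finset.mem_sigma] at h
    simp [Finset.insert_erase h.2]
  · rintro ⟨i, X⟩ h
    simp only [Finset.mem_sigma, Finset.mem_powersetCard, Finset.subset_erase] at h
    simp [Finset.erase_insert h.2.1.2]

/-- Powers of an operator that adds one element of `U s` at a time, where adding `i` multiplies
the weight of each `x` with `r x i` by `p ^ 2`. -/
theorem pow_apply_eq_sum_powersetCard {K M : Type*} [Field K] [AddCommGroup M] [Module K M]
    (r : α → α → Prop) [DecidableRel r] (p : K) (hp : p ≠ 0) (c : ℕ → K) (hc₀ : c 0 = 1)
    (hc : ∀ (k : ℕ) (Y : Finset α), Y.card = k + 1 →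
      c k * ∑ i ∈ Y, (p ^ 2) ^ ((Y.filter fun x => r x i).card) = c (k + 1))
    (hr : ∀ i, ¬ r i i)
    (T : Module.End K M) (v : β → M) (U : β → Finset α) (w : α → β → ℤ) (act : Finset α → β → β)
    (hT : ∀ s, T (v s) = ∑ i ∈ U s, p ^ w i s • v (act {i} s))
    (hU : ∀ s, ∀ i ∈ U s, U (act {i} s) = (U s).erase i)
    (hw : ∀ s, ∀ i ∈ U s, ∀ x, w x (act {i} s) = w x s + if r x i then 2 else 0)
    (hact₀ : ∀ s, act ∅ s = s)
    (hact : ∀ s i X, act X (act {i} s) = act (insert i X) s) (k : ℕ) (s : β) :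
    (T ^ k) (v s) = c k • ∑ X ∈ (U s).powersetCard k, p ^ (∑ i ∈ X, w i s) • v (act X s) := by
  induction k generalizing s with
  | zero => simp [hc₀, hact₀]
  | succ k ih =>
    have step : (T ^ (k + 1)) (v s) = c k • ∑ i ∈ U s, ∑ X ∈ ((U s).erase i).powersetCard k,
        (p ^ (w i s) * p ^ (∑ x ∈ X, w x (act {i} s))) • v (act (insert i X) s) := by
      rw [pow_succ, Module.End.mul_apply, hT, map_sum, Finset.smul_sum]
      refine Finset.sum_congr rfl fun i hi => ?_
      rw [map_smul, ih, hU s i hi, smul_comm, Finset.smul_sum]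
      simp only [smul_smul, hact]
    rw [step, Finset.sum_sum_powersetCard_erase, Finset.smul_sum, Finset.smul_sum]
    refine Finset.sum_congr rfl fun Y hY => ?_
    obtain ⟨hYU, hYk⟩ := Finset.mem_powersetCard.1 hY
    rw [← hc k Y hYk, mul_smul, Finset.sum_smul]
    congr 1
    refine Finset.sum_congr rfl fun i hi => ?_
    rw [Finset.insert_erase hi, smul_smul]
    congr 1
    have hfilter : ((Y.erase i).filter fun x => r x i) = Y.filter fun x => r x i := by
      ext x
      simp only [Finset.mem_filter, Finset.mem_erase]
      exact ⟨fun h => ⟨h.1.2, h.2⟩, fun h => ⟨⟨fun e => hr i (e ▸ h.2), h.1⟩, h.2⟩⟩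
    have hsum : ∑ x ∈ Y.erase i, w x (act {i} s) =
        ∑ x ∈ Y.erase i, w x s + 2 * ((Y.filter fun x => r x i).card : ℤ) := by
      rw [Finset.sum_congr rfl fun x _ => hw s i (hYU hi) x, Finset.sum_add_distrib,
        ← Finset.sum_filter, hfilter, Finset.sum_const, nsmul_eq_mul, mul_comm]
    rw [hsum, ← zpow_add₀ hp, ← Finset.add_sum_erase Y (fun x => w x s) hi, ← add_assoc,
      zpow_add₀ hp, mul_comm, zpow_mul, zpow_natCast]
    norm_cast

theorem Finset.sum_pow_card_filter_lt {α R : Type*} [LinearOrder α] [Semiring R] (x : R)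
    (Y : Finset α) :
    ∑ i ∈ Y, x ^ (Y.filter (· < i)).card = ∑ j ∈ Finset.range Y.card, x ^ j := by
  induction Y using Finset.induction_on_max with
  | empty => simp
  | insert a Y ha ih =>
    have haY : a ∉ Y := fun h => lt_irrefl _ (ha a h)
    rw [Finset.sum_insert haY, Finset.card_insert_of_notMem haY, Finset.sum_range_succ, ← ih,
      add_comm]
    congr 1
    · refine Finset.sum_congr rfl fun i hi => ?_
      rw [Finset.filter_insert, if_neg (ha i hi).not_gt]
    · rw [Finset.filter_insert, if_neg (lt_irrefl a), Finset.filter_true_of_mem ha]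

theorem Finset.sum_pow_card_filter_gt {α R : Type*} [LinearOrder α] [Semiring R] (x : R)
    (Y : Finset α) :
    ∑ i ∈ Y, x ^ (Y.filter (i < ·)).card = ∑ j ∈ Finset.range Y.card, x ^ j :=
  Finset.sum_pow_card_filter_lt (α := αᵒᵈ) x Y

end PowerExpansion

theorem qv_ne_zero : qv ≠ 0 := RatFunc.X_ne_zero

theorem qv_pow_ne_one {m : ℕ} (hm : m ≠ 0) : qv ^ m ≠ 1 := by
  intro h
  have h' : algebraMap (Polynomial ℚ) Fq (Polynomial.X ^ m) = algebraMap (Polynomial ℚ) Fq 1 := by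
    simpa [qv] using h
  have := congrArg Polynomial.natDegree (RatFunc.algebraMap_injective ℚ h')
  simp at this
  exact hm this

theorem qv_sub_inv_ne_zero : qv - qv⁻¹ ≠ 0 := by
  intro h
  refine qv_pow_ne_one two_ne_zero ?_
  rw [sub_eq_zero] at h
  rw [pow_two]
  nth_rw 1 [h]
  exact inv_mul_cancel₀ qv_ne_zero

theorem qNum_ne_zero {m : ℕ} (hm : m ≠ 0) : qNum qv m ≠ 0 := by
  refine div_ne_zero (fun h => ?_) qv_sub_inv_ne_zero
  refine qv_pow_ne_one (m := m + m) (by omega) ?_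
  rw [sub_eq_zero, zpow_neg, zpow_natCast] at h
  rw [pow_add]
  nth_rw 1 [h]
  exact inv_mul_cancel₀ (pow_ne_zero _ qv_ne_zero)

theorem qFact_ne_zero (m : ℕ) : qFact qv m ≠ 0 :=
  Finset.prod_ne_zero_iff.2 fun j _ => qNum_ne_zero j.succ_ne_zero

theorem sum_range_qv_sq_pow (k : ℕ) :
    ∑ j ∈ Finset.range (k + 1), (qv ^ 2) ^ j = qv ^ k * qNum qv (k + 1) := by
  have hq := qv_ne_zero
  have h2 : qv ^ 2 - 1 ≠ 0 := sub_ne_zero.2 (qv_pow_ne_one two_ne_zero)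
  rw [geom_sum_eq (qv_pow_ne_one two_ne_zero), qNum, zpow_neg, zpow_natCast]
  have h3 := qv_sub_inv_ne_zero
  field_simp
  ring

theorem qFact_mul_pow_succ (k : ℕ) :
    qFact qv k * qv ^ (k * (k - 1) / 2) * ∑ j ∈ Finset.range (k + 1), ((-qv) ^ 2) ^ j =
      qFact qv (k + 1) * qv ^ ((k + 1) * (k + 1 - 1) / 2) := by
  have hexp : (k + 1) * (k + 1 - 1) / 2 = k * (k - 1) / 2 + k := by
    rw [← Finset.sum_range_id, ← Finset.sum_range_id, Finset.sum_range_succ]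
  rw [neg_sq, sum_range_qv_sq_pow, hexp, pow_add, qFact, qFact, Finset.prod_range_succ]
  ring

/-- The `i ∈ {1,…,n}` with `{i, −i} ⊆ S₀^c`. -/
def undotted (n : ℕ) (S : Finset ℤ) : Finset ℤ :=
  (Finset.Icc (1 : ℤ) (n : ℤ)).filter (fun i => i ∈ Szeroc n S ∧ -i ∈ Szeroc n S)

/-- The `i ∈ {1,…,n}` with `{i, −i} ⊆ S₀`. -/
def dotted (n : ℕ) (S : Finset ℤ) : Finset ℤ :=
  (Finset.Icc (1 : ℤ) (n : ℤ)).filter (fun i => i ∈ Szero S ∧ -i ∈ Szero S)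

theorem mem_Iset {n : ℕ} {x : ℤ} : x ∈ Iset n ↔ x ≠ 0 ∧ -(n : ℤ) ≤ x ∧ x ≤ n := by
  simp [Iset]

theorem mem_negSet {S : Finset ℤ} {x : ℤ} : x ∈ negSet S ↔ -x ∈ S := by
  simp [negSet, neg_eq_iff_eq_neg]

theorem mem_Szero {S : Finset ℤ} {x : ℤ} : x ∈ Szero S ↔ x ∈ S ∧ -x ∈ S := by
  simp [Szero, mem_negSet]

theorem mem_Szeroc {n : ℕ} {S : Finset ℤ} {x : ℤ} :
    x ∈ Szeroc n S ↔ x ∈ Iset n ∧ x ∉ S ∧ -x ∉ S := by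
  simp only [Szeroc, Finset.mem_inter, Finset.mem_sdiff, mem_negSet, mem_Iset]
  constructor
  · tauto
  · rintro ⟨⟨h₀, h₁, h₂⟩, h⟩
    exact ⟨⟨⟨h₀, h₁, h₂⟩, h.1⟩, ⟨by omega, by omega, by omega⟩, h.2⟩

theorem mem_undotted {n : ℕ} {S : Finset ℤ} {i : ℤ} :
    i ∈ undotted n S ↔ (1 ≤ i ∧ i ≤ n) ∧ i ∉ S ∧ -i ∉ S := by
  simp only [undotted, Finset.mem_filter, Finset.mem_Icc, mem_Szeroc, mem_Iset, neg_neg]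
  constructor
  · tauto
  · rintro ⟨⟨h₁, h₂⟩, h⟩
    exact ⟨⟨h₁, h₂⟩, ⟨⟨by omega, by omega, by omega⟩, h⟩, ⟨by omega, by omega, by omega⟩, h.symm⟩

theorem mem_dotted {n : ℕ} {S : Finset ℤ} {i : ℤ} :
    i ∈ dotted n S ↔ (1 ≤ i ∧ i ≤ n) ∧ i ∈ S ∧ -i ∈ S := by
  simp only [dotted, Finset.mem_filter, Finset.mem_Icc, mem_Szero, neg_neg]
  tauto

theorem Szero_insert_pair (S : Finset ℤ) (i : ℤ) (hi : i ∉ S) (hi' : -i ∉ S) :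
    Szero (insert i (insert (-i) S)) = insert i (insert (-i) (Szero S)) := by
  ext x
  simp only [mem_Szero, Finset.mem_insert]
  by_cases h₁ : x = i
  · subst h₁; simp
  by_cases h₂ : x = -i
  · subst h₂; simp
  have h₃ : -x ≠ i := fun h => h₂ (by omega)
  have h₄ : -x ≠ -i := fun h => h₁ (by omega)
  tauto

theorem insert_pair_Szeroc (n : ℕ) (S : Finset ℤ) {i : ℤ} (hi : i ∈ undotted n S) :
    insert i (insert (-i) (Szeroc n (insert i (insert (-i) S)))) = Szeroc n S := by
  obtain ⟨h, hiS, hiS'⟩ := mem_undotted.1 hi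
  ext x
  simp only [mem_Szeroc, Finset.mem_insert, mem_Iset]
  by_cases h₁ : x = i
  · subst h₁
    simp only [true_or, true_iff]
    exact ⟨⟨by omega, by omega, by omega⟩, hiS, hiS'⟩
  by_cases h₂ : x = -i
  · subst h₂
    simp only [true_or, or_true, true_iff, neg_neg]
    exact ⟨⟨by omega, by omega, by omega⟩, hiS', hiS⟩
  have h₃ : -x ≠ i := fun h => h₂ (by omega)
  have h₄ : -x ≠ -i := fun h => h₁ (by omega)
  tauto

theorem card_filter_insert_pair (A : Finset ℤ) (P : ℤ → Prop) [DecidablePred P] {i : ℤ}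
    (h₀ : i ≠ 0) (hi : i ∉ A) (hi' : -i ∉ A) (hP : P (-i) ↔ P i) :
    (((insert i (insert (-i) A)).filter P).card : ℤ) =
      (A.filter P).card + if P i then 2 else 0 := by
  have h : i ≠ -i := by omega
  by_cases hp : P i
  · rw [Finset.filter_insert, Finset.filter_insert, if_pos hp, if_pos (hP.2 hp), if_pos hp,
      Finset.card_insert_of_notMem (by simp [h, hi]), Finset.card_insert_of_notMem (by simp [hi'])]
    push_cast
    ring
  · rw [Finset.filter_insert, Finset.filter_insert, if_neg hp, if_neg (fun h => hp (hP.1 h)),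
      if_neg hp, add_zero]

theorem card_filter_Szero_insert_pair {n : ℕ} {S : Finset ℤ} (P : ℤ → Prop) [DecidablePred P]
    {i : ℤ} (hi : i ∈ undotted n S) (hP : P (-i) ↔ P i) :
    (((Szero (insert i (insert (-i) S))).filter P).card : ℤ) =
      ((Szero S).filter P).card + if P i then 2 else 0 := by
  obtain ⟨h, hiS, hiS'⟩ := mem_undotted.1 hi
  rw [Szero_insert_pair S i hiS hiS']
  exact card_filter_insert_pair _ P (by omega) (by simp [mem_Szero, hiS])
    (by simp [mem_Szero, hiS]) hP

theorem card_filter_Szeroc_insert_pair {n : ℕ} {S : Finset ℤ} (P : ℤ → Prop) [DecidablePred P]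
    {i : ℤ} (hi : i ∈ undotted n S) (hP : P (-i) ↔ P i) :
    (((Szeroc n S).filter P).card : ℤ) =
      ((Szeroc n (insert i (insert (-i) S))).filter P).card + if P i then 2 else 0 := by
  obtain ⟨h, hiS, hiS'⟩ := mem_undotted.1 hi
  rw [← insert_pair_Szeroc n S hi]
  exact card_filter_insert_pair _ P (by omega) (by simp [mem_Szeroc])
    (by simp [mem_Szeroc]) hP

theorem wGt_insert_pair {n : ℕ} {S : Finset ℤ} {i : ℤ} (hi : i ∈ undotted n S) (x : ℤ) :
    wGt n x (insert i (insert (-i) S)) = wGt n x S + if x < i then 2 else 0 := by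
  obtain ⟨h, -⟩ := mem_undotted.1 hi
  have habs : |i| = i := abs_of_pos (by omega)
  unfold wGt
  rw [card_filter_Szero_insert_pair _ hi (by rw [abs_neg]),
    card_filter_Szeroc_insert_pair (S := S) _ hi (by rw [abs_neg])]
  simp only [habs, h.2, and_true]
  split_ifs <;> omega

theorem wLt_insert_pair {n : ℕ} {S : Finset ℤ} {i : ℤ} (hi : i ∈ undotted n S) (x : ℤ) :
    wLt n x S = wLt n x (insert i (insert (-i) S)) + if i < x then 2 else 0 := by
  obtain ⟨h, -⟩ := mem_undotted.1 hi
  have habs : |i| = i := abs_of_pos (by omega)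
  have h₀ : i ≠ 0 := by omega
  unfold wLt
  rw [card_filter_Szero_insert_pair _ hi (by rw [abs_neg, neg_ne_zero]),
    card_filter_Szeroc_insert_pair (S := S) _ hi (by rw [abs_neg, neg_ne_zero])]
  simp only [habs, h₀, ne_eq, not_false_eq_true, true_and]
  split_ifs <;> omega

theorem negSet_singleton (i : ℤ) : negSet {i} = {-i} := by simp [negSet]

theorem negSet_insert (i : ℤ) (X : Finset ℤ) : negSet (insert i X) = insert (-i) (negSet X) := by
  simp [negSet]

theorem union_singleton_negSet (S : Finset ℤ) (i : ℤ) :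
    S ∪ {i} ∪ negSet {i} = insert i (insert (-i) S) := by
  ext x
  simp only [negSet_singleton, Finset.mem_union, Finset.mem_singleton, Finset.mem_insert]
  tauto

theorem sdiff_singleton_negSet (S : Finset ℤ) (i : ℤ) :
    S \ ({i} ∪ negSet {i}) = (S.erase i).erase (-i) := by
  ext x
  simp only [negSet_singleton, Finset.mem_union, Finset.mem_singleton, Finset.mem_sdiff,
    Finset.mem_erase]
  tauto

theorem undotted_insert_pair (n : ℕ) (S : Finset ℤ) (i : ℤ) (hi : 1 ≤ i) :
    undotted n (insert i (insert (-i) S)) = (undotted n S).erase i := by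
  ext x
  simp only [Finset.mem_erase, mem_undotted, Finset.mem_insert, neg_inj, not_or]
  constructor
  · tauto
  · rintro ⟨h, h', hS⟩
    exact ⟨h', ⟨h, by omega, hS.1⟩, by omega, h, hS.2⟩

theorem vS_of_not_subset {n : ℕ} {S : Finset ℤ} (h : ¬ S ⊆ Iset n) : vS n S = 0 := dif_neg h

theorem vS_coe {n : ℕ} (S : Bset n) : vS n S.1 = bv n S := dif_pos S.2

theorem mkOp_bv (n : ℕ) (g : Bset n → Lam n) (S : Bset n) : mkOp n g (bv n S) = g S := by
  simp [mkOp, bv]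

theorem dotted_erase_pair (n : ℕ) (S : Finset ℤ) (i : ℤ) (hi : 1 ≤ i) :
    dotted n ((S.erase i).erase (-i)) = (dotted n S).erase i := by
  ext x
  simp only [Finset.mem_erase, mem_dotted, ne_eq, neg_inj]
  constructor
  · tauto
  · rintro ⟨h, h', hS⟩
    exact ⟨h', ⟨by omega, h, hS.1⟩, h, by omega, hS.2⟩

theorem insert_pair_erase_pair {n : ℕ} {S : Finset ℤ} {i : ℤ} (hi : i ∈ dotted n S) :
    insert i (insert (-i) ((S.erase i).erase (-i))) = S := by
  obtain ⟨h, hiS, hiS'⟩ := mem_dotted.1 hi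
  rw [Finset.insert_erase (Finset.mem_erase.2 ⟨by omega, hiS'⟩), Finset.insert_erase hiS]

theorem mem_undotted_erase_pair {n : ℕ} {S : Finset ℤ} {i : ℤ} (hi : i ∈ dotted n S) :
    i ∈ undotted n ((S.erase i).erase (-i)) := by
  simp [mem_undotted, (mem_dotted.1 hi).1]

theorem Eop_vS (n : ℕ) (S : Finset ℤ) : Eop n (vS n S) = EAct n S := by
  by_cases h : S ⊆ Iset n
  · exact (congrArg (Eop n) (vS_coe ⟨S, h⟩)).trans (mkOp_bv n _ ⟨S, h⟩)
  · rw [vS_of_not_subset h, map_zero, EAct, Finset.sum_eq_zero]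
    intro i _
    rw [vS_of_not_subset, smul_zero]
    exact fun hsub => h fun x hx =>
      hsub (Finset.mem_insert_of_mem (Finset.mem_insert_of_mem hx))

theorem Fop_vS (n : ℕ) (S : Finset ℤ) : Fop n (vS n S) = FAct n S := by
  by_cases h : S ⊆ Iset n
  · exact (congrArg (Fop n) (vS_coe ⟨S, h⟩)).trans (mkOp_bv n _ ⟨S, h⟩)
  · rw [vS_of_not_subset h, map_zero, FAct, Finset.sum_eq_zero]
    intro i hi
    rw [vS_of_not_subset, smul_zero]
    obtain ⟨hn, -⟩ := mem_dotted.1 hi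
    intro hsub
    refine h fun x hx => ?_
    by_cases hx₁ : x = i
    · exact mem_Iset.2 ⟨by omega, by omega, by omega⟩
    by_cases hx₂ : x = -i
    · exact mem_Iset.2 ⟨by omega, by omega, by omega⟩
    exact hsub (by simp [hx, hx₁, hx₂])

theorem Eop_pow_vS (n k : ℕ) (S : Finset ℤ) :
    (Eop n ^ k) (vS n S) = (qFact qv k * qv ^ (k * (k - 1) / 2)) •
      ∑ X ∈ (undotted n S).powersetCard k,
        ((-qv) ^ (∑ i ∈ X, wGt n i S)) • vS n (S ∪ X ∪ negSet X) := by
  refine pow_apply_eq_sum_powersetCard (fun x i => x < i) (-qv) (neg_ne_zero.2 qv_ne_zero)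
    (fun k => qFact qv k * qv ^ (k * (k - 1) / 2)) (by simp [qFact]) ?_ (fun i => lt_irrefl i)
    (Eop n) (vS n) (undotted n) (wGt n) (fun X S => S ∪ X ∪ negSet X) ?_ ?_ ?_ ?_ ?_ k S
  · intro k Y hY
    rw [Finset.sum_pow_card_filter_lt, hY]
    exact qFact_mul_pow_succ k
  · intro S
    simp only [union_singleton_negSet]
    exact Eop_vS n S
  · intro S i hi
    rw [union_singleton_negSet, undotted_insert_pair n S i (mem_undotted.1 hi).1.1]
  · intro S i hi x
    rw [union_singleton_negSet, wGt_insert_pair hi]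
  · intro S
    simp [negSet]
  · intro S i X
    ext x
    simp only [negSet_insert, negSet_singleton, Finset.mem_union, Finset.mem_singleton,
      Finset.mem_insert]
    tauto

theorem Fop_pow_vS (n k : ℕ) (S : Finset ℤ) :
    (Fop n ^ k) (vS n S) = (qFact qv k * qv ^ (k * (k - 1) / 2)) •
      ∑ X ∈ (dotted n S).powersetCard k,
        ((-qv) ^ (∑ i ∈ X, wLt n i S)) • vS n (S \ (X ∪ negSet X)) := by
  refine pow_apply_eq_sum_powersetCard (fun x i => i < x) (-qv) (neg_ne_zero.2 qv_ne_zero)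
    (fun k => qFact qv k * qv ^ (k * (k - 1) / 2)) (by simp [qFact]) ?_ (fun i => lt_irrefl i)
    (Fop n) (vS n) (dotted n) (wLt n) (fun X S => S \ (X ∪ negSet X)) ?_ ?_ ?_ ?_ ?_ k S
  · intro k Y hY
    rw [Finset.sum_pow_card_filter_gt, hY]
    exact qFact_mul_pow_succ k
  · intro S
    simp only [sdiff_singleton_negSet]
    exact Fop_vS n S
  · intro S i hi
    rw [sdiff_singleton_negSet, dotted_erase_pair n S i (mem_dotted.1 hi).1.1]
  · intro S i hi x
    rw [sdiff_singleton_negSet, wLt_insert_pair (mem_undotted_erase_pair hi),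
      insert_pair_erase_pair hi]
  · intro S
    simp [negSet]
  · intro S i X
    ext x
    simp only [negSet_insert, negSet_singleton, Finset.mem_union, Finset.mem_singleton,
      Finset.mem_insert, Finset.mem_sdiff]
    tauto

theorem qv_mem_Asub : qv ∈ Asub := Subring.subset_closure (by simp)

theorem qv_inv_mem_Asub : qv⁻¹ ∈ Asub := Subring.subset_closure (by simp)

theorem neg_qv_zpow_mem_Asub (z : ℤ) : (-qv) ^ z ∈ Asub := by
  cases z with
  | ofNat m =>
    rw [Int.ofNat_eq_natCast, zpow_natCast]
    exact pow_mem (neg_mem qv_mem_Asub) m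
  | negSucc m =>
    rw [zpow_negSucc, ← inv_pow, inv_neg]
    exact pow_mem (neg_mem qv_inv_mem_Asub) _

theorem mem_LamA {n : ℕ} {x : Lam n} : x ∈ LamA n ↔ ∀ S, x S ∈ Asub := by
  have h (c : Bset n →₀ Fq) : c.sum (fun S a => a • bv n S) = c := by
    simp [bv]
  constructor
  · rintro ⟨c, hc, rfl⟩
    rwa [h]
  · exact fun hx => ⟨x, hx, (h x).symm⟩

theorem LamA_smul_mem {n : ℕ} {a : Fq} {x : Lam n} (ha : a ∈ Asub) (hx : x ∈ LamA n) :
    a • x ∈ LamA n :=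
  mem_LamA.2 fun S => mul_mem ha (mem_LamA.1 hx S)

theorem LamA_sum_mem {n : ℕ} {ι : Type*} (s : Finset ι) (f : ι → Lam n)
    (hf : ∀ i ∈ s, f i ∈ LamA n) : ∑ i ∈ s, f i ∈ LamA n :=
  mem_LamA.2 fun S => by
    rw [Finsupp.finsetSum_apply]
    exact sum_mem fun i hi => mem_LamA.1 (hf i hi) S

theorem vS_mem_LamA (n : ℕ) (T : Finset ℤ) : vS n T ∈ LamA n := by
  classical
  refine mem_LamA.2 fun S => ?_
  unfold vS
  split_ifs with h
  · rw [Finsupp.single_apply]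
    split_ifs
    exacts [one_mem _, zero_mem _]
  · exact zero_mem _

theorem map_mem_LamA {n : ℕ} (T : Module.End Fq (Lam n)) (hT : ∀ S, T (bv n S) ∈ LamA n)
    {x : Lam n} (hx : x ∈ LamA n) : T x ∈ LamA n := by
  obtain ⟨c, hc, rfl⟩ := hx
  rw [Finsupp.sum, map_sum]
  refine LamA_sum_mem _ _ fun S _ => ?_
  rw [map_smul]
  exact LamA_smul_mem (hc S) (hT S)

theorem divided_smul_mem_LamA {n : ℕ} (k m : ℕ) {ι : Type*} (s : Finset ι) (w : ι → ℤ)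
    (T : ι → Finset ℤ) :
    (qFact qv k)⁻¹ • (qFact qv k * qv ^ m) • ∑ X ∈ s, ((-qv) ^ w X) • vS n (T X) ∈ LamA n := by
  rw [smul_smul, inv_mul_cancel_left₀ (qFact_ne_zero k)]
  exact LamA_smul_mem (pow_mem qv_mem_Asub m) <| LamA_sum_mem _ _ fun X _ =>
    LamA_smul_mem (neg_qv_zpow_mem_Asub _) (vS_mem_LamA n _)

/-- closed formulas for E^k·v_S and F^k·v_S; in particular the divided powers
E^{(k)} = E^k/[k]! and F^{(k)} = F^k/[k]! preserve the A-lattice Λ_A. -/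
theorem stmt5 (n : ℕ) (hn : 1 ≤ n) :
    (∀ (k : ℕ) (S : Bset n),
      ((Eop n ^ k) (bv n S) =
        (qFact qv k * qv ^ (k * (k - 1) / 2)) •
          ∑ X ∈ ((Finset.Icc (1 : ℤ) (n : ℤ)).filter
              (fun i => i ∈ Szeroc n S.1 ∧ -i ∈ Szeroc n S.1)).powersetCard k,
            ((-qv) ^ (∑ i ∈ X, wGt n i S.1)) • vS n (S.1 ∪ X ∪ negSet X)) ∧
      ((Fop n ^ k) (bv n S) =
        (qFact qv k * qv ^ (k * (k - 1) / 2)) •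
          ∑ X ∈ ((Finset.Icc (1 : ℤ) (n : ℤ)).filter
              (fun i => i ∈ Szero S.1 ∧ -i ∈ Szero S.1)).powersetCard k,
            ((-qv) ^ (∑ i ∈ X, wLt n i S.1)) • vS n (S.1 \ (X ∪ negSet X)))) ∧
    (∀ k : ℕ, ∀ x ∈ LamA n, (Ediv n k) x ∈ LamA n ∧ (Fdiv n k) x ∈ LamA n) := by
  refine ⟨fun k S => ⟨?_, ?_⟩, fun k x hx => ⟨map_mem_LamA _ (fun S => ?_) hx,
    map_mem_LamA _ (fun S => ?_) hx⟩⟩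
  · rw [← vS_coe]
    exact Eop_pow_vS n k S.1
  · rw [← vS_coe]
    exact Fop_pow_vS n k S.1
  · rw [Ediv, LinearMap.smul_apply, ← vS_coe, Eop_pow_vS]
    exact divided_smul_mem_LamA _ _ _ _ _
  · rw [Fdiv, LinearMap.smul_apply, ← vS_coe, Fop_pow_vS]
    exact divided_smul_mem_LamA _ _ _ _ _

end
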